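/- Let (Λ,η) be a full isothermic surface in S^n, n ≥ 3, with two Darboux transforms Λ̂₁ and Λ̂₂ of distinct parameters m₁ ≠ m₂, and let w ∈ ℝ^{n+1,1} be such that w ∉ Λ_x^⊥ for all x ∈ Σ and w never belongs to the spherical systems of Λ and Λ̂₁ nor of Λ and Λ̂₂. If the sphere-planes of Λ̂₁ and Λ̂₂ with respect to w coincide and contain no principal direction of Λ, then (Λ,η) is a special isothermic surface of type 2 with respect to a polynomial conserved quantity p(t) with p_0 ∈ ⟨w⟩, and Λ̂₁ and Λ̂₂ are complementary surfaces of (Λ,η) with respect to p(t). Conversely, if (Λ,η) is special isothermic of type 2 in E(w) with complementary surfaces Λ̂₁, Λ̂₂, then the sphere-planes through Λ̂₁ and through Λ̂₂ with respect to w coincide. -/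

import Mathlib

noncomputable section

open Finset

/-- Minkowski space `ℝ^{n+1,1}`, modelled on `Fin (n+2) → ℝ`. -/
abbrev MV (n : ℕ) : Type := EuclideanSpace ℝ (Fin (n + 2))

/-- The Minkowski inner product of signature `(n+1,1)`. -/
def mink (n : ℕ) (x y : MV n) : ℝ :=
  ∑ i : Fin (n + 1), x i.castSucc * y i.castSucc
    - x (Fin.last (n + 1)) * y (Fin.last (n + 1))

/-- The light cone `L ⊂ ℝ^{n+1,1}`. -/
def LightCone (n : ℕ) : Set (MV n) := {v | v ≠ 0 ∧ mink n v v = 0}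

/-- The skew endomorphism `u ∧ v`, acting by `(u ∧ v) w = (u,w)v − (v,w)u`. -/
def wedge (n : ℕ) (u v w : MV n) : MV n :=
  mink n u w • v - mink n v w • u

/-- The surface domain: a two-dimensional coordinate chart. -/
abbrev Surf : Type := ℝ × ℝ

/-- the coordinate direction ∂/∂u -/
def du : Surf := (1, 0)

/-- the coordinate direction ∂/∂v -/
def dv : Surf := (0, 1)

/-- partial derivative of a section in a coordinate direction -/
def pd {n : ℕ} (e : Surf) (f : Surf → MV n) (x : Surf) : MV n :=
  fderiv ℝ f x e

lemma mink_add_left (n : ℕ) (a b c : MV n) :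
    mink n (a + b) c = mink n a c + mink n b c := by
  simp [mink, PiLp.add_apply, add_mul, Finset.sum_add_distrib]; ring

lemma mink_smul_left (n : ℕ) (r : ℝ) (a c : MV n) :
    mink n (r • a) c = r * mink n a c := by
  simp [mink, PiLp.smul_apply, smul_eq_mul, mul_sub, Finset.mul_sum, mul_assoc]

lemma mink_zero_left (n : ℕ) (c : MV n) : mink n 0 c = 0 := by
  simp [mink]

/-- An isothermic surface `(Λ,η)` in `S^n = P(L)`, given by a nowhere-zero null
lift `F` of the immersion `Λ` together with the 1-form
`η = F ∧ W₁ du + F ∧ W₂ dv` with values in `Λ ∧ Λ^⊥`. -/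
structure IsothermicSurface (n : ℕ) : Type where
  F : Surf → MV n
  W₁ : Surf → MV n
  W₂ : Surf → MV n
  smooth_F : ContDiff ℝ (⊤ : ℕ∞) F
  smooth_W₁ : ContDiff ℝ (⊤ : ℕ∞) W₁
  smooth_W₂ : ContDiff ℝ (⊤ : ℕ∞) W₂
  F_ne : ∀ x, F x ≠ 0
  F_null : ∀ x, mink n (F x) (F x) = 0
  immersed : ∀ x, LinearIndependent ℝ ![F x, pd du F x, pd dv F x]
  W₁_perp : ∀ x, mink n (F x) (W₁ x) = 0
  W₂_perp : ∀ x, mink n (F x) (W₂ x) = 0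
  eta_ne : ∃ x z, wedge n (F x) (W₁ x) z ≠ 0 ∨ wedge n (F x) (W₂ x) z ≠ 0
  eta_closed : ∀ x z,
    fderiv ℝ (fun y => wedge n (F y) (W₂ y) z) x du
      = fderiv ℝ (fun y => wedge n (F y) (W₁ y) z) x dv

/-- `s` is a parallel section for the flat connection `∇^t = d + tη`. -/
def ParallelSection (n : ℕ) (S : IsothermicSurface n) (t : ℝ)
    (s : Surf → MV n) : Prop :=
  ∀ x, fderiv ℝ s x du + t • wedge n (S.F x) (S.W₁ x) (s x) = 0
     ∧ fderiv ℝ s x dv + t • wedge n (S.F x) (S.W₂ x) (s x) = 0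

/-- A polynomial conserved quantity of degree `d` of the isothermic surface
`(Λ,η)`: a polynomial `p(t) = Σ_{k=0}^d p_k t^k` of (smooth) sections, of exact
degree `d`, with `∇^t p(t) = 0` for all `t`. -/
structure PolyConservedQuantity (n : ℕ) (S : IsothermicSurface n) (d : ℕ) : Type where
  coeff : ℕ → Surf → MV n
  smooth : ∀ k, ContDiff ℝ (⊤ : ℕ∞) (coeff k)
  coeff_eq_zero : ∀ k, d < k → coeff k = 0
  top_ne : coeff d ≠ 0
  conserved : ∀ t : ℝ, ParallelSection n S t
    (fun x => ∑ k ∈ Finset.range (d + 1), t ^ k • coeff k x)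

/-- evaluation `p(t)` of a polynomial conserved quantity -/
def pcEval {n : ℕ} {S : IsothermicSurface n} {d : ℕ}
    (p : PolyConservedQuantity n S d) (t : ℝ) (x : Surf) : MV n :=
  ∑ k ∈ Finset.range (d + 1), t ^ k • p.coeff k x

/-- `(Λ,η)` is a special isothermic surface of type `d`. -/
def SpecialOfType (n : ℕ) (S : IsothermicSurface n) (d : ℕ) : Prop :=
  Nonempty (PolyConservedQuantity n S d)

/-- `p₀ ∈ ⟨w⟩`: the polynomial conserved quantity exhibits `(Λ,η)` as special
isothermic in the space-form `E(w)`. -/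
def InSpaceForm {n : ℕ} {S : IsothermicSurface n} {d : ℕ}
    (p : PolyConservedQuantity n S d) (w : MV n) : Prop :=
  ∃ c : ℝ, ∀ x, p.coeff 0 x = c • w

/-- fullness: the image of `Λ` lies in no proper subsphere -/
def Full (n : ℕ) (S : IsothermicSurface n) : Prop :=
  ¬ ∃ p : MV n, p ≠ 0 ∧ ∀ x, mink n p (S.F x) = 0
/-- A Darboux transform `Λ̂` of `(Λ,η)` with parameter `m`, given by a
`∇^m`-parallel null lift `G` spanning an immersed surface with `Λ̂ ∩ Λ = 0`. -/
structure DarbouxTransform (n : ℕ) (S : IsothermicSurface n) (m : ℝ) : Type where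
  G : Surf → MV n
  smooth_G : ContDiff ℝ (⊤ : ℕ∞) G
  G_ne : ∀ x, G x ≠ 0
  G_null : ∀ x, mink n (G x) (G x) = 0
  immersed : ∀ x, LinearIndependent ℝ ![G x, pd du G x, pd dv G x]
  disjoint : ∀ x, G x ∉ Submodule.span ℝ {S.F x}
  parallel : ParallelSection n S m G

/-- The gauge transformation `Γ_{⟨F⟩}^{⟨G⟩}(c)`: acts as `c` on `⟨G⟩`, as `1` on
`(⟨F⟩ ⊕ ⟨G⟩)^⊥` and as `c⁻¹` on `⟨F⟩`. -/
def gaugeG (n : ℕ) (F G : MV n) (c : ℝ) (z : MV n) : MV n :=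
  ((mink n G z / mink n F G) / c) • F
    + (c * (mink n F z / mink n F G)) • G
    + (z - (mink n G z / mink n F G) • F - (mink n F z / mink n F G) • G)

/-- `Γ_Λ^{Λ̂}(1 − t/m) · (d + tη) = d + tη̂` for all `t ≠ m`: the gauge relation
between the pencils of flat connections of an isothermic surface `S` and of (an
isothermic structure `T` on) its Darboux transform with parameter `m`. -/
def GaugeRel (n : ℕ) (S T : IsothermicSurface n) (m : ℝ) : Prop :=
  ∀ t : ℝ, t ≠ m → ∀ s : Surf → MV n, ContDiff ℝ (⊤ : ℕ∞) s → ∀ x : Surf,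
    (fderiv ℝ (fun y => gaugeG n (S.F y) (T.F y) (1 - t / m) (s y)) x du
        + t • wedge n (T.F x) (T.W₁ x) (gaugeG n (S.F x) (T.F x) (1 - t / m) (s x))
      = gaugeG n (S.F x) (T.F x) (1 - t / m)
          (fderiv ℝ s x du + t • wedge n (S.F x) (S.W₁ x) (s x)))
    ∧ (fderiv ℝ (fun y => gaugeG n (S.F y) (T.F y) (1 - t / m) (s y)) x dv
        + t • wedge n (T.F x) (T.W₂ x) (gaugeG n (S.F x) (T.F x) (1 - t / m) (s x))
      = gaugeG n (S.F x) (T.F x) (1 - t / m)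
          (fderiv ℝ s x dv + t • wedge n (S.F x) (S.W₂ x) (s x)))

/-- `Λ̂ = ⟨p(m)⟩` with `(p(m),p(m)) = 0`: the Darboux transform `D` is a
complementary surface of `(Λ,η)` with respect to `p(t)`. -/
def IsComplementary (n : ℕ) {S : IsothermicSurface n} {d : ℕ}
    (p : PolyConservedQuantity n S d) {m : ℝ} (D : DarbouxTransform n S m) : Prop :=
  (∀ x, mink n (pcEval p m x) (pcEval p m x) = 0) ∧
  (∀ x, Submodule.span ℝ {D.G x} = Submodule.span ℝ {pcEval p m x})

/-- `m` is a repeated root of the (constant-coefficient) polynomial `(p(t),p(t))`. -/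
def IsRepeatedRootAt {n : ℕ} {S : IsothermicSurface n} {d : ℕ}
    (p : PolyConservedQuantity n S d) (m : ℝ) : Prop :=
  ∀ x, mink n (pcEval p m x) (pcEval p m x) = 0
    ∧ deriv (fun t : ℝ => mink n (pcEval p t x) (pcEval p t x)) m = 0
/-- metric coefficient `g₁₁ = (F_u,F_u)` of the induced metric -/
def gUU (n : ℕ) (F : Surf → MV n) (x : Surf) : ℝ := mink n (pd du F x) (pd du F x)

/-- metric coefficient `g₁₂ = (F_u,F_v)` -/
def gUV (n : ℕ) (F : Surf → MV n) (x : Surf) : ℝ := mink n (pd du F x) (pd dv F x)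

/-- metric coefficient `g₂₂ = (F_v,F_v)` -/
def gVV (n : ℕ) (F : Surf → MV n) (x : Surf) : ℝ := mink n (pd dv F x) (pd dv F x)

/-- `(𝐇, N)`, the inner product of the mean curvature vector of `F` (in a
space-form `E(w)`) with a normal field `N`: half the trace with respect to the
induced metric of the `N`-component of the second fundamental form. -/
def meanCurv (n : ℕ) (F N : Surf → MV n) (x : Surf) : ℝ :=
  (gVV n F x * mink n (pd du (pd du F) x) (N x)
    - 2 * gUV n F x * mink n (pd du (pd dv F) x) (N x)
    + gUU n F x * mink n (pd dv (pd dv F) x) (N x))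
  / (2 * (gUU n F x * gVV n F x - gUV n F x ^ 2))

/-- `N` is a unit normal field of the lift `F : Σ → E(w)`. -/
def IsUnitNormal (n : ℕ) (F N : Surf → MV n) (w : MV n) : Prop :=
  (∀ x, mink n (N x) (N x) = 1) ∧ (∀ x, mink n (N x) w = 0)
    ∧ (∀ x, mink n (N x) (F x) = 0)
    ∧ (∀ x, mink n (N x) (pd du F x) = 0) ∧ (∀ x, mink n (N x) (pd dv F x) = 0)

/-- `N` is parallel for the normal connection of `F : Σ → E(w)`: the derivative
of `N` has no component in the normal bundle of `F` in `E(w)`. -/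
def ParallelNormal (n : ℕ) (F N : Surf → MV n) (w : MV n) : Prop :=
  ∀ x e, fderiv ℝ N x e ∈ Submodule.span ℝ {F x, pd du F x, pd dv F x, w}

/-- the chart coordinates `(u,v)` are conformal curvature line coordinates
corresponding to `η`, with conformal factor `e^{2θ}`:
`I = e^{2θ}(du² + dv²)` and `η = e^{−2θ} F ∧ (−F_u du + F_v dv)`. -/
def ConformalCoords (n : ℕ) (S : IsothermicSurface n) (θ : Surf → ℝ) : Prop :=
  ContDiff ℝ (⊤ : ℕ∞) θ
  ∧ (∀ x, mink n (pd du S.F x) (pd du S.F x) = Real.exp (2 * θ x))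
  ∧ (∀ x, mink n (pd dv S.F x) (pd dv S.F x) = Real.exp (2 * θ x))
  ∧ (∀ x, mink n (pd du S.F x) (pd dv S.F x) = 0)
  ∧ (∀ x z, wedge n (S.F x) (S.W₁ x) z
      = Real.exp (-(2 * θ x)) • wedge n (S.F x) (-pd du S.F x) z)
  ∧ (∀ x z, wedge n (S.F x) (S.W₂ x) z
      = Real.exp (-(2 * θ x)) • wedge n (S.F x) (pd dv S.F x) z)

/-- the second fundamental form of the lift `F` in `E(w)` with respect to the
unit normal `N` is `II = e^{2θ}(k₁ du² + k₂ dv²)`. -/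
def PrincipalCurvatures (n : ℕ) (S : IsothermicSurface n) (N : Surf → MV n)
    (θ k₁ k₂ : Surf → ℝ) : Prop :=
  (∀ x, mink n (pd du (pd du S.F) x) (N x) = Real.exp (2 * θ x) * k₁ x)
  ∧ (∀ x, mink n (pd du (pd dv S.F) x) (N x) = 0)
  ∧ (∀ x, mink n (pd dv (pd dv S.F) x) (N x) = Real.exp (2 * θ x) * k₂ x)

/-- partial derivative of a real function on the surface -/
def pdR (e : Surf) (f : Surf → ℝ) (x : Surf) : ℝ := fderiv ℝ f x e
/-- `(Λ^c, η^c)` is the Christoffel transform of `(Λ,η)` with respect to the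
pair `(v∞, v₀)`, witnessed by the stereoprojections `f`, `f^c` into
`ℝ^n = ⟨v₀,v∞⟩^⊥`:  `F = exp(f ∧ v∞)v₀`, `F^c = exp(f^c ∧ v₀)v∞`,
`η = Ad(exp(f ∧ v∞))(df^c ∧ v₀)` and `η^c = Ad(exp(f^c ∧ v₀))(df ∧ v∞)`. -/
def IsChristoffelPair (n : ℕ) (S Sc : IsothermicSurface n) (vinf v0 : MV n)
    (f fc : Surf → MV n) : Prop :=
  vinf ∈ LightCone n ∧ v0 ∈ LightCone n ∧ mink n v0 vinf = -1
  ∧ ContDiff ℝ (⊤ : ℕ∞) f ∧ ContDiff ℝ (⊤ : ℕ∞) fc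
  ∧ (∀ x, mink n (f x) v0 = 0) ∧ (∀ x, mink n (f x) vinf = 0)
  ∧ (∀ x, mink n (fc x) v0 = 0) ∧ (∀ x, mink n (fc x) vinf = 0)
  ∧ (∀ x, S.F x = v0 + f x + (mink n (f x) (f x) / 2) • vinf)
  ∧ (∀ x, Sc.F x = vinf + fc x + (mink n (fc x) (fc x) / 2) • v0)
  ∧ (∀ x z, wedge n (S.F x) (S.W₁ x) z
      = wedge n (pd du fc x + mink n (f x) (pd du fc x) • vinf) (S.F x) z)
  ∧ (∀ x z, wedge n (S.F x) (S.W₂ x) z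
      = wedge n (pd dv fc x + mink n (f x) (pd dv fc x) • vinf) (S.F x) z)
  ∧ (∀ x z, wedge n (Sc.F x) (Sc.W₁ x) z
      = wedge n (pd du f x + mink n (fc x) (pd du f x) • v0) (Sc.F x) z)
  ∧ (∀ x z, wedge n (Sc.F x) (Sc.W₂ x) z
      = wedge n (pd dv f x + mink n (fc x) (pd dv f x) • v0) (Sc.F x) z)

/-- `Φ` is an orthogonal gauge transformation with `Φ · (d + sη) = d`. -/
def IsTGauge (n : ℕ) (S : IsothermicSurface n) (s : ℝ)
    (Φ : Surf → MV n → MV n) : Prop :=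
  (∀ x, IsLinearMap ℝ (Φ x))
  ∧ (∀ x z z', mink n (Φ x z) (Φ x z') = mink n z z')
  ∧ (∀ σ : Surf → MV n, ContDiff ℝ (⊤ : ℕ∞) σ → ∀ x,
      (fderiv ℝ (fun y => Φ y (σ y)) x du
         = Φ x (fderiv ℝ σ x du + s • wedge n (S.F x) (S.W₁ x) (σ x)))
      ∧ (fderiv ℝ (fun y => Φ y (σ y)) x dv
         = Φ x (fderiv ℝ σ x dv + s • wedge n (S.F x) (S.W₂ x) (σ x))))

/-- `(Λ_s, η_s)` is the T-transform of `(Λ,η)` associated to `Φ_s`: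
`Λ_s = Φ_s Λ` and `η_s = Ad(Φ_s) η`. -/
def IsTTransform (n : ℕ) (S : IsothermicSurface n) (s : ℝ)
    (Φ : Surf → MV n → MV n) (Ss : IsothermicSurface n) : Prop :=
  IsTGauge n S s Φ
  ∧ (∀ x, Ss.F x = Φ x (S.F x))
  ∧ (∀ x z, wedge n (Ss.F x) (Ss.W₁ x) (Φ x z) = Φ x (wedge n (S.F x) (S.W₁ x) z))
  ∧ (∀ x z, wedge n (Ss.F x) (Ss.W₂ x) (Φ x z) = Φ x (wedge n (S.F x) (S.W₂ x) z))

/-- orthogonal complement with respect to the Minkowski form -/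
def mperp (n : ℕ) (U : Submodule ℝ (MV n)) : Submodule ℝ (MV n) where
  carrier := {v | ∀ u ∈ U, mink n v u = 0}
  add_mem' := by
    intro a b ha hb u hu
    rw [mink_add_left, ha u hu, hb u hu, add_zero]
  zero_mem' := by
    intro u hu; exact mink_zero_left n u
  smul_mem' := by
    intro r a ha u hu
    rw [mink_smul_left, ha u hu, mul_zero]

/-- the spherical system of `Λ` and a Darboux transform `Λ̂ = ⟨G⟩`: the
`(n−2)`-sphere congruence `C = Λ ⊕ Λ̂ ⊕ V_R^⊥`, `V_R = Λ^{(1)} ⊕ Λ̂`. -/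
def sphericalSystem (n : ℕ) (S : IsothermicSurface n) (G : Surf → MV n)
    (x : Surf) : Submodule ℝ (MV n) :=
  Submodule.span ℝ {S.F x, G x}
    ⊔ mperp n (Submodule.span ℝ {S.F x, pd du S.F x, pd dv S.F x, G x})

/-- the sphere-planes congruence `P = C + ⟨w⟩` of `Λ` and `Λ̂ = ⟨G⟩` with
respect to `w`. -/
def spherePlanes (n : ℕ) (S : IsothermicSurface n) (G : Surf → MV n)
    (w : MV n) (x : Surf) : Submodule ℝ (MV n) :=
  sphericalSystem n S G x ⊔ Submodule.span ℝ {w}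
lemma mink_comm (n : ℕ) (a b : MV n) : mink n a b = mink n b a := by
  simp [mink, mul_comm]

lemma mink_add_right (n : ℕ) (a b c : MV n) :
    mink n a (b + c) = mink n a b + mink n a c := by
  rw [mink_comm, mink_add_left, mink_comm n b, mink_comm n c]

lemma mink_smul_right (n : ℕ) (r : ℝ) (a c : MV n) :
    mink n a (r • c) = r * mink n a c := by
  rw [mink_comm, mink_smul_left, mink_comm n c]

lemma mink_zero_right (n : ℕ) (a : MV n) : mink n a 0 = 0 := by
  rw [mink_comm, mink_zero_left]

lemma mink_neg_left (n : ℕ) (a c : MV n) : mink n (-a) c = -mink n a c := by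
  rw [← neg_one_smul ℝ a, mink_smul_left]; ring

lemma mink_sub_left (n : ℕ) (a b c : MV n) :
    mink n (a - b) c = mink n a c - mink n b c := by
  rw [sub_eq_add_neg, mink_add_left, mink_neg_left]; ring

lemma mink_sub_right (n : ℕ) (a b c : MV n) :
    mink n a (b - c) = mink n a b - mink n a c := by
  rw [mink_comm, mink_sub_left, mink_comm n b, mink_comm n c]

/-- The Minkowski inner product as a bilinear form. -/
def minkForm (n : ℕ) : LinearMap.BilinForm ℝ (MV n) :=
  LinearMap.mk₂ ℝ (mink n) (mink_add_left n) (mink_smul_left n)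
    (mink_add_right n) (mink_smul_right n)

lemma minkForm_apply (n : ℕ) (a b : MV n) : minkForm n a b = mink n a b := rfl

lemma eq_zero_of_mink_eq_zero (n : ℕ) (a : MV n) (h : ∀ b, mink n a b = 0) : a = 0 := by
  ext i
  have hi := h (EuclideanSpace.single i 1)
  induction i using Fin.lastCases with
  | last => simpa [mink, Fin.castSucc_ne_last] using hi
  | cast i =>
    simpa [mink, Fin.castSucc_ne_last, (Fin.castSucc_ne_last _).symm] using hi

lemma minkForm_nondegenerate (n : ℕ) : (minkForm n).Nondegenerate :=
  ⟨fun a h => eq_zero_of_mink_eq_zero n a h,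
    fun a h => eq_zero_of_mink_eq_zero n a fun b => by rw [mink_comm]; exact h b⟩

lemma minkForm_isRefl (n : ℕ) : (minkForm n).IsRefl := fun a b h => by
  rw [minkForm_apply, mink_comm]; exact h

lemma mem_mperp (n : ℕ) (U : Submodule ℝ (MV n)) (v : MV n) :
    v ∈ mperp n U ↔ ∀ u ∈ U, mink n v u = 0 := Iff.rfl

lemma mperp_eq_orthogonal (n : ℕ) (U : Submodule ℝ (MV n)) :
    mperp n U = (minkForm n).orthogonal U := by
  ext v
  rw [mem_mperp, LinearMap.BilinForm.mem_orthogonal_iff]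
  exact forall₂_congr fun u _ => by rw [minkForm_apply, mink_comm]

lemma mperp_mperp (n : ℕ) (U : Submodule ℝ (MV n)) : mperp n (mperp n U) = U := by
  rw [mperp_eq_orthogonal, mperp_eq_orthogonal]
  exact LinearMap.BilinForm.orthogonal_orthogonal (minkForm_nondegenerate n)
    (minkForm_isRefl n) U

lemma mperp_sup (n : ℕ) (U V : Submodule ℝ (MV n)) :
    mperp n (U ⊔ V) = mperp n U ⊓ mperp n V := by
  ext v
  simp only [Submodule.mem_inf, mem_mperp]
  refine ⟨fun h => ⟨fun u hu => h u (Submodule.mem_sup_left hu),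
    fun u hu => h u (Submodule.mem_sup_right hu)⟩, fun h u hu => ?_⟩
  obtain ⟨a, ha, b, hb, rfl⟩ := Submodule.mem_sup.1 hu
  rw [mink_add_right, h.1 a ha, h.2 b hb, add_zero]

lemma mem_mperp_span (n : ℕ) (s : Set (MV n)) (v : MV n) :
    v ∈ mperp n (Submodule.span ℝ s) ↔ ∀ u ∈ s, mink n v u = 0 := by
  rw [mem_mperp]
  refine ⟨fun h u hu => h u (Submodule.subset_span hu), fun h u hu => ?_⟩
  induction hu using Submodule.span_induction with
  | mem u hu => exact h u hu
  | zero => exact mink_zero_right n v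
  | add a b _ _ ha hb => rw [mink_add_right, ha, hb, add_zero]
  | smul r a _ ha => rw [mink_smul_right, ha, mul_zero]

/-- A null vector with vanishing time component is zero. -/
lemma eq_zero_of_null_of_last_eq_zero (n : ℕ) (a : MV n) (ha : mink n a a = 0)
    (h0 : a (Fin.last (n + 1)) = 0) : a = 0 := by
  have h : ∑ i : Fin (n + 1), a i.castSucc * a i.castSucc = 0 := by
    simpa [mink, h0] using ha
  rw [Finset.sum_eq_zero_iff_of_nonneg fun i _ => mul_self_nonneg _] at h
  ext i
  induction i using Fin.lastCases with
  | last => exact h0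
  | cast i => exact mul_self_eq_zero.1 (h i (Finset.mem_univ i))

/-- Orthogonal null vectors are proportional. -/
lemma mem_span_of_null_of_mink_eq_zero (n : ℕ) (a b : MV n) (ha : a ≠ 0)
    (haa : mink n a a = 0) (hbb : mink n b b = 0) (hab : mink n a b = 0) :
    b ∈ Submodule.span ℝ {a} := by
  set l := Fin.last (n + 1)
  have hl : a l ≠ 0 := fun h => ha (eq_zero_of_null_of_last_eq_zero n a haa h)
  have hz : a l • b - b l • a = 0 := by
    apply eq_zero_of_null_of_last_eq_zero
    · simp only [mink_sub_left, mink_sub_right, mink_smul_left, mink_smul_right,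
        haa, hbb, hab, mink_comm n b a]
      ring
    · simp [l, mul_comm]
  refine Submodule.mem_span_singleton.2 ⟨b l / a l, ?_⟩
  rw [sub_eq_zero] at hz
  rw [div_eq_inv_mul, mul_smul, ← hz, smul_smul, inv_mul_cancel₀ hl, one_smul]

/-! ### Calculus of sections -/

lemma ContDiff.mink {n : ℕ} {f g : Surf → MV n} (hf : ContDiff ℝ (⊤ : ℕ∞) f)
    (hg : ContDiff ℝ (⊤ : ℕ∞) g) :
    ContDiff ℝ (⊤ : ℕ∞) (fun x => mink n (f x) (g x)) :=
  ((LinearMap.toContinuousBilinearMap (minkForm n)).isBoundedBilinearMap.contDiff).comp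
    (hf.prodMk hg)

lemma contDiff_pd {n : ℕ} {f : Surf → MV n} (hf : ContDiff ℝ (⊤ : ℕ∞) f) (e : Surf) :
    ContDiff ℝ (⊤ : ℕ∞) (pd e f) :=
  (hf.fderiv_right (m := (⊤ : ℕ∞)) (by simp)).clm_apply contDiff_const

lemma contDiff_pdR {f : Surf → ℝ} (hf : ContDiff ℝ (⊤ : ℕ∞) f) (e : Surf) :
    ContDiff ℝ (⊤ : ℕ∞) (pdR e f) :=
  (hf.fderiv_right (m := (⊤ : ℕ∞)) (by simp)).clm_apply contDiff_const

lemma ContDiff.diffAt {E : Type*} [NormedAddCommGroup E] [NormedSpace ℝ E]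
    {f : Surf → E} (hf : ContDiff ℝ (⊤ : ℕ∞) f) (x : Surf) : DifferentiableAt ℝ f x :=
  hf.differentiable (by simp) x

lemma pdR_mink {n : ℕ} {f g : Surf → MV n} (hf : ContDiff ℝ (⊤ : ℕ∞) f)
    (hg : ContDiff ℝ (⊤ : ℕ∞) g) (e x : Surf) :
    pdR e (fun y => mink n (f y) (g y)) x
      = mink n (pd e f x) (g x) + mink n (f x) (pd e g x) := by
  have h := (LinearMap.toContinuousBilinearMap (minkForm n)).hasFDerivAt_of_bilinear
    (hf.diffAt x).hasFDerivAt (hg.diffAt x).hasFDerivAt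
  have h2 := congrArg (fun L => L e) h.fderiv
  refine h2.trans ?_
  simp only [add_apply, ContinuousLinearMap.precompR_apply,
    ContinuousLinearMap.precompL_apply]
  exact add_comm _ _

lemma pdR_mink_const {n : ℕ} {f : Surf → MV n} (hf : ContDiff ℝ (⊤ : ℕ∞) f) (c : MV n)
    (e x : Surf) : pdR e (fun y => mink n (f y) c) x = mink n (pd e f x) c := by
  rw [pdR_mink hf contDiff_const]
  simp [pd, mink_zero_right]

lemma pdR_mul {f g : Surf → ℝ} (hf : ContDiff ℝ (⊤ : ℕ∞) f)
    (hg : ContDiff ℝ (⊤ : ℕ∞) g) (e x : Surf) :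
    pdR e (fun y => f y * g y) x = pdR e f x * g x + f x * pdR e g x := by
  have h := congrArg (fun L => L e) ((hf.diffAt x).hasFDerivAt.mul (hg.diffAt x).hasFDerivAt).fderiv
  refine h.trans ?_
  simp only [add_apply, smul_apply, smul_eq_mul, pdR]
  ring

lemma pdR_sub {f g : Surf → ℝ} (hf : ContDiff ℝ (⊤ : ℕ∞) f)
    (hg : ContDiff ℝ (⊤ : ℕ∞) g) (e x : Surf) :
    pdR e (fun y => f y - g y) x = pdR e f x - pdR e g x := by
  have h := congrArg (fun L => L e) ((hf.diffAt x).hasFDerivAt.sub (hg.diffAt x).hasFDerivAt).fderiv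
  exact h.trans (by simp [pdR])

lemma pdR_const_mul {f : Surf → ℝ} (hf : ContDiff ℝ (⊤ : ℕ∞) f) (c : ℝ) (e x : Surf) :
    pdR e (fun y => c * f y) x = c * pdR e f x := by
  rw [pdR_mul contDiff_const hf]
  simp [pdR]

lemma fderiv_fderiv_comm {E : Type*} [NormedAddCommGroup E] [NormedSpace ℝ E]
    {f : Surf → E} (hf : ContDiff ℝ (⊤ : ℕ∞) f) (a b x : Surf) :
    fderiv ℝ (fun y => fderiv ℝ f y b) x a = fderiv ℝ (fun y => fderiv ℝ f y a) x b := by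
  have hd : DifferentiableAt ℝ (fderiv ℝ f) x :=
    (hf.fderiv_right (m := (⊤ : ℕ∞)) (by simp)).diffAt x
  have key : ∀ a b : Surf,
      fderiv ℝ (fun y => fderiv ℝ f y b) x a = fderiv ℝ (fderiv ℝ f) x a b := fun a b => by
    rw [fderiv_clm_apply hd (differentiableAt_const b)]
    simp
  rw [key, key]
  exact (hf.contDiffAt.isSymmSndFDerivAt (by
    rw [minSmoothness_of_isRCLikeNormedField]
    exact WithTop.coe_le_coe.2 (le_top : (2 : ℕ∞) ≤ ⊤))) a b

lemma pd_comm {n : ℕ} {f : Surf → MV n} (hf : ContDiff ℝ (⊤ : ℕ∞) f) (a b x : Surf) :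
    pd a (pd b f) x = pd b (pd a f) x := fderiv_fderiv_comm hf a b x

lemma pdR_comm {f : Surf → ℝ} (hf : ContDiff ℝ (⊤ : ℕ∞) f) (a b x : Surf) :
    pdR a (pdR b f) x = pdR b (pdR a f) x := fderiv_fderiv_comm hf a b x

lemma exists_const_of_pdR_eq_zero {f : Surf → ℝ} (hf : ContDiff ℝ (⊤ : ℕ∞) f)
    (hu : ∀ x, pdR du f x = 0) (hv : ∀ x, pdR dv f x = 0) : ∃ c, ∀ x, f x = c := by
  refine ⟨f 0, fun x => is_const_of_fderiv_eq_zero (hf.differentiable (by simp)) (fun y => ?_) x 0⟩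
  ext
  · simpa [pdR, du] using hu y
  · simpa [pdR, dv] using hv y

/-- The Wronskian-type expression `W ∂_e g − g ∂_e W`. -/
def wronsk (W g : Surf → ℝ) (e x : Surf) : ℝ := W x * pdR e g x - pdR e W x * g x

lemma contDiff_wronsk {W g : Surf → ℝ} (hW : ContDiff ℝ (⊤ : ℕ∞) W)
    (hg : ContDiff ℝ (⊤ : ℕ∞) g) (e : Surf) : ContDiff ℝ (⊤ : ℕ∞) (wronsk W g e) :=
  (hW.mul (contDiff_pdR hg e)).sub ((contDiff_pdR hW e).mul hg)

lemma pdR_wronsk {W g : Surf → ℝ} (hW : ContDiff ℝ (⊤ : ℕ∞) W)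
    (hg : ContDiff ℝ (⊤ : ℕ∞) g) (a e x : Surf) :
    pdR a (wronsk W g e) x = (pdR a W x * pdR e g x - pdR e W x * pdR a g x)
      + (W x * pdR a (pdR e g) x - pdR a (pdR e W) x * g x) := by
  have h : wronsk W g e = fun y => W y * pdR e g y - pdR e W y * g y := rfl
  rw [h, pdR_sub (hW.mul (contDiff_pdR hg e)) ((contDiff_pdR hW e).mul hg),
    pdR_mul hW (contDiff_pdR hg e), pdR_mul (contDiff_pdR hW e) hg]
  ring

/-- The second order equation satisfied by the inner products of a lift with the
parallel sections of an isothermic surface, relative to the solution `W`. -/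
def ConjugateNetEq (φ W g : Surf → ℝ) : Prop :=
  ∀ x, 2 * φ x * (W x * pdR du (pdR dv g) x - pdR du (pdR dv W) x * g x)
    + pdR du φ x * wronsk W g dv x + pdR dv φ x * wronsk W g du x = 0

/-- Two solutions of the same conjugate net equation whose quotients by `W` have
proportional differentials are, up to a constant multiple of `W`, constant
multiples of each other. -/
lemma exists_const_of_wronsk_proportional {φ W g₁ g₂ : Surf → ℝ}
    (hW : ContDiff ℝ (⊤ : ℕ∞) W) (hg₁ : ContDiff ℝ (⊤ : ℕ∞) g₁)
    (hg₂ : ContDiff ℝ (⊤ : ℕ∞) g₂) (hφ : ∀ x, φ x ≠ 0) (hW0 : ∀ x, W x ≠ 0)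
    (e₁ : ConjugateNetEq φ W g₁) (e₂ : ConjugateNetEq φ W g₂)
    (hr : ∀ x, wronsk W g₁ du x ≠ 0) (hs : ∀ x, wronsk W g₁ dv x ≠ 0)
    (hp : ∀ x, wronsk W g₁ dv x * wronsk W g₂ du x = wronsk W g₁ du x * wronsk W g₂ dv x) :
    ∃ κ δ : ℝ, (∀ x, κ * g₁ x - g₂ x = δ * W x)
      ∧ ∀ e ∈ ({du, dv} : Set Surf), ∀ x, wronsk W g₂ e x = κ * wronsk W g₁ e x := by
  set K : Surf → ℝ := fun x => wronsk W g₂ du x / wronsk W g₁ du x with hK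
  have hKs : ContDiff ℝ (⊤ : ℕ∞) K :=
    (contDiff_wronsk hW hg₂ du).div (contDiff_wronsk hW hg₁ du) hr
  have hKu : ∀ x, wronsk W g₂ du x = K x * wronsk W g₁ du x := fun x => by
    rw [hK]; field_simp [hr x]
  have hKv : ∀ x, wronsk W g₂ dv x = K x * wronsk W g₁ dv x := fun x => by
    have := hp x
    have h1 := hr x
    rw [hK]; field_simp; linarith
  have hfu : wronsk W g₂ du = fun x => K x * wronsk W g₁ du x := funext hKu
  have hfv : wronsk W g₂ dv = fun x => K x * wronsk W g₁ dv x := funext hKv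
  -- the mixed second derivative and the cross term scale by `K`
  have hD : ∀ x, W x * pdR du (pdR dv g₂) x - pdR du (pdR dv W) x * g₂ x
      = K x * (W x * pdR du (pdR dv g₁) x - pdR du (pdR dv W) x * g₁ x) := fun x => by
    have a := e₁ x
    have b := e₂ x
    rw [hKu, hKv] at b
    apply mul_left_cancel₀ (mul_ne_zero two_ne_zero (hφ x))
    linear_combination b - K x * a
  have hE : ∀ x, pdR dv W x * pdR du g₂ x - pdR du W x * pdR dv g₂ x
      = K x * (pdR dv W x * pdR du g₁ x - pdR du W x * pdR dv g₁ x) := fun x => by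
    have a := hKu x
    have b := hKv x
    simp only [wronsk] at a b
    apply mul_left_cancel₀ (hW0 x)
    linear_combination pdR dv W x * a - pdR du W x * b
  have hKdv : ∀ x, pdR dv K x = 0 := fun x => by
    have a := pdR_wronsk hW hg₂ dv du x
    rw [hfu, pdR_mul hKs (contDiff_wronsk hW hg₁ du), pdR_wronsk hW hg₁,
      pdR_comm hg₂ dv du, pdR_comm hg₁ dv du, pdR_comm hW dv du, hD, hE] at a
    apply mul_right_cancel₀ (hr x)
    linear_combination a
  have hKdu : ∀ x, pdR du K x = 0 := fun x => by
    have a := pdR_wronsk hW hg₂ du dv x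
    rw [hfv, pdR_mul hKs (contDiff_wronsk hW hg₁ dv), pdR_wronsk hW hg₁, hD] at a
    apply mul_right_cancel₀ (hs x)
    linear_combination a - hE x
  obtain ⟨κ, hκ⟩ := exists_const_of_pdR_eq_zero hKs hKdu hKdv
  simp only [hκ] at hKu hKv
  have hnum : ContDiff ℝ (⊤ : ℕ∞) (fun x => κ * g₁ x - g₂ x) :=
    (contDiff_const.mul hg₁).sub hg₂
  set Q : Surf → ℝ := fun x => (κ * g₁ x - g₂ x) / W x with hQ
  have hQs : ContDiff ℝ (⊤ : ℕ∞) Q := hnum.div hW hW0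
  have hQW : (fun x => Q x * W x) = fun x => κ * g₁ x - g₂ x := funext fun x => by
    rw [hQ]; field_simp [hW0 x]
  have hQe : ∀ e x, wronsk W g₂ e x = κ * wronsk W g₁ e x → pdR e Q x = 0 := fun e x h => by
    have a := pdR_mul hQs hW e x
    rw [hQW, pdR_sub (contDiff_const.mul hg₁) hg₂, pdR_const_mul hg₁] at a
    have b : Q x * W x = κ * g₁ x - g₂ x := congrFun hQW x
    simp only [wronsk] at h
    apply mul_right_cancel₀ (hW0 x)
    apply mul_right_cancel₀ (hW0 x)
    linear_combination -W x * a - pdR e W x * b - h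
  obtain ⟨δ, hδ⟩ := exists_const_of_pdR_eq_zero hQs (fun x => hQe du x (hKu x))
    (fun x => hQe dv x (hKv x))
  refine ⟨κ, δ, fun x => ?_, ?_⟩
  · rw [← congrFun hQW x, hδ]
  · rintro e (rfl | rfl)
    exacts [hKu, hKv]

/-! ### Isothermic surfaces in conformal curvature line coordinates -/

section Conformal

variable {n : ℕ} {S : IsothermicSurface n} {θ : Surf → ℝ} {m : ℝ}

/-- The inverse conformal factor `e^{-2θ}`. -/
def invConf (θ : Surf → ℝ) (x : Surf) : ℝ := Real.exp (-(2 * θ x))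

lemma invConf_ne_zero (θ : Surf → ℝ) (x : Surf) : invConf θ x ≠ 0 := (Real.exp_pos _).ne'

lemma ConformalCoords.contDiff_invConf (hcc : ConformalCoords n S θ) :
    ContDiff ℝ (⊤ : ℕ∞) (invConf θ) :=
  Real.contDiff_exp.comp (contDiff_const.mul hcc.1).neg

lemma ConformalCoords.wedge_W₁ (hcc : ConformalCoords n S θ) (x : Surf) (z : MV n) :
    wedge n (S.F x) (S.W₁ x) z
      = invConf θ x • (mink n (pd du S.F x) z • S.F x - mink n (S.F x) z • pd du S.F x) := by
  rw [hcc.2.2.2.2.1, wedge, mink_neg_left, invConf]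
  module

lemma ConformalCoords.wedge_W₂ (hcc : ConformalCoords n S θ) (x : Surf) (z : MV n) :
    wedge n (S.F x) (S.W₂ x) z
      = invConf θ x • (mink n (S.F x) z • pd dv S.F x - mink n (pd dv S.F x) z • S.F x) := by
  rw [hcc.2.2.2.2.2, wedge, invConf]

lemma mink_F_pd (S : IsothermicSurface n) (e x : Surf) : mink n (S.F x) (pd e S.F x) = 0 := by
  have h := pdR_mink S.smooth_F S.smooth_F e x
  rw [mink_comm n (pd e S.F x), funext S.F_null] at h
  have h0 : pdR e (fun _ => (0 : ℝ)) x = 0 := by simp [pdR]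
  linarith

lemma mink_pd_F (S : IsothermicSurface n) (e x : Surf) : mink n (pd e S.F x) (S.F x) = 0 := by
  rw [mink_comm, mink_F_pd]

lemma linComb_F_du (S : IsothermicSurface n) (x : Surf) (a b : ℝ)
    (h : a • S.F x + b • pd du S.F x = 0) : a = 0 ∧ b = 0 := by
  have := Fintype.linearIndependent_iff.1 (S.immersed x) ![a, b, 0]
    (by simpa [Fin.sum_univ_three] using h)
  exact ⟨this 0, this 1⟩

lemma linComb_F_dv (S : IsothermicSurface n) (x : Surf) (a b : ℝ)
    (h : a • S.F x + b • pd dv S.F x = 0) : a = 0 ∧ b = 0 := by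
  have := Fintype.linearIndependent_iff.1 (S.immersed x) ![a, 0, b]
    (by simpa [Fin.sum_univ_three] using h)
  exact ⟨this 0, this 2⟩

/-- The closedness of `η`, evaluated on two constant vectors. -/
lemma ConformalCoords.eta_closed_mink (hcc : ConformalCoords n S θ) (w c : MV n) (x : Surf) :
    2 * invConf θ x * (mink n (S.F x) w * mink n (pd du (pd dv S.F) x) c
        - mink n (pd du (pd dv S.F) x) w * mink n (S.F x) c)
      + pdR du (invConf θ) x * (mink n (S.F x) w * mink n (pd dv S.F x) c
        - mink n (pd dv S.F x) w * mink n (S.F x) c)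
      + pdR dv (invConf θ) x * (mink n (S.F x) w * mink n (pd du S.F x) c
        - mink n (pd du S.F x) w * mink n (S.F x) c) = 0 := by
  have hF := S.smooth_F
  have hFu := contDiff_pd hF du
  have hFv := contDiff_pd hF dv
  have hφ := hcc.contDiff_invConf
  have sc : ∀ {f : Surf → MV n}, ContDiff ℝ (⊤ : ℕ∞) f → ∀ z,
      ContDiff ℝ (⊤ : ℕ∞) (fun y => mink n (f y) z) := fun hf z => hf.mink contDiff_const
  have h2 : (fun y => wedge n (S.F y) (S.W₂ y) w) = fun y => invConf θ y •
      (mink n (S.F y) w • pd dv S.F y - mink n (pd dv S.F y) w • S.F y) :=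
    funext fun y => hcc.wedge_W₂ y w
  have h1 : (fun y => wedge n (S.F y) (S.W₁ y) w) = fun y => invConf θ y •
      (mink n (pd du S.F y) w • S.F y - mink n (S.F y) w • pd du S.F y) :=
    funext fun y => hcc.wedge_W₁ y w
  have s2 : ContDiff ℝ (⊤ : ℕ∞) (fun y => invConf θ y •
      (mink n (S.F y) w • pd dv S.F y - mink n (pd dv S.F y) w • S.F y)) :=
    hφ.smul (((sc hF w).smul hFv).sub ((sc hFv w).smul hF))
  have s1 : ContDiff ℝ (⊤ : ℕ∞) (fun y => invConf θ y •
      (mink n (pd du S.F y) w • S.F y - mink n (S.F y) w • pd du S.F y)) :=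
    hφ.smul (((sc hFu w).smul hF).sub ((sc hF w).smul hFu))
  have h := congrArg (fun v => mink n v c) (S.eta_closed x w)
  rw [h1, h2] at h
  have h' := (pdR_mink_const s2 c du x).trans (h.trans (pdR_mink_const s1 c dv x).symm)
  simp only [mink_smul_left, mink_sub_left] at h'
  rw [pdR_mul hφ (((sc hF w).mul (sc hFv c)).sub ((sc hFv w).mul (sc hF c))),
    pdR_mul hφ (((sc hFu w).mul (sc hF c)).sub ((sc hF w).mul (sc hFu c))),
    pdR_sub ((sc hF w).mul (sc hFv c)) ((sc hFv w).mul (sc hF c)),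
    pdR_sub ((sc hFu w).mul (sc hF c)) ((sc hF w).mul (sc hFu c)),
    pdR_mul (sc hF w) (sc hFv c), pdR_mul (sc hFv w) (sc hF c),
    pdR_mul (sc hFu w) (sc hF c), pdR_mul (sc hF w) (sc hFu c)] at h'
  simp only [pdR_mink_const hF, pdR_mink_const hFu, pdR_mink_const hFv] at h'
  rw [pd_comm hF dv du] at h'
  linear_combination h'

namespace DarbouxTransform

lemma pd_du_G (hcc : ConformalCoords n S θ) (D : DarbouxTransform n S m) (x : Surf) :
    pd du D.G x = (m * invConf θ x) •
      (mink n (S.F x) (D.G x) • pd du S.F x - mink n (pd du S.F x) (D.G x) • S.F x) := by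
  have h := (D.parallel x).1
  rw [hcc.wedge_W₁, ← eq_neg_iff_add_eq_zero] at h
  rw [pd, h]
  module

lemma pd_dv_G (hcc : ConformalCoords n S θ) (D : DarbouxTransform n S m) (x : Surf) :
    pd dv D.G x = (m * invConf θ x) •
      (mink n (pd dv S.F x) (D.G x) • S.F x - mink n (S.F x) (D.G x) • pd dv S.F x) := by
  have h := (D.parallel x).2
  rw [hcc.wedge_W₂, ← eq_neg_iff_add_eq_zero] at h
  rw [pd, h]
  module

lemma mink_F_G_ne_zero (D : DarbouxTransform n S m) (x : Surf) :
    mink n (S.F x) (D.G x) ≠ 0 := fun h =>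
  D.disjoint x (mem_span_of_null_of_mink_eq_zero n _ _ (S.F_ne x) (S.F_null x) (D.G_null x) h)

lemma contDiff_mink_F_G (D : DarbouxTransform n S m) :
    ContDiff ℝ (⊤ : ℕ∞) (fun x => mink n (S.F x) (D.G x)) := S.smooth_F.mink D.smooth_G

lemma pdR_du_mink_F_G (hcc : ConformalCoords n S θ) (D : DarbouxTransform n S m) (x : Surf) :
    pdR du (fun y => mink n (S.F y) (D.G y)) x = mink n (pd du S.F x) (D.G x) := by
  rw [pdR_mink S.smooth_F D.smooth_G, D.pd_du_G hcc]
  simp only [mink_smul_right, mink_sub_right, mink_F_pd, S.F_null]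
  ring

lemma pdR_dv_mink_F_G (hcc : ConformalCoords n S θ) (D : DarbouxTransform n S m) (x : Surf) :
    pdR dv (fun y => mink n (S.F y) (D.G y)) x = mink n (pd dv S.F x) (D.G x) := by
  rw [pdR_mink S.smooth_F D.smooth_G, D.pd_dv_G hcc]
  simp only [mink_smul_right, mink_sub_right, mink_F_pd, S.F_null]
  ring

lemma pdR_du_dv_mink_F_G (hcc : ConformalCoords n S θ) (D : DarbouxTransform n S m) (x : Surf) :
    pdR du (pdR dv (fun y => mink n (S.F y) (D.G y))) x
      = mink n (pd du (pd dv S.F) x) (D.G x) := by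
  rw [funext (D.pdR_dv_mink_F_G hcc), pdR_mink (contDiff_pd S.smooth_F dv) D.smooth_G,
    D.pd_du_G hcc]
  simp only [mink_smul_right, mink_sub_right, mink_pd_F]
  rw [mink_comm n (pd dv S.F x), hcc.2.2.2.1]
  ring

lemma conjugateNetEq (hcc : ConformalCoords n S θ) (D : DarbouxTransform n S m) (w : MV n) :
    ConjugateNetEq (invConf θ) (fun x => mink n (S.F x) w)
      (fun x => mink n (S.F x) (D.G x)) := fun x => by
  have h : pdR dv (fun y => mink n (S.F y) w) = fun y => mink n (pd dv S.F y) w :=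
    funext (pdR_mink_const S.smooth_F w dv)
  simp only [wronsk, D.pdR_du_dv_mink_F_G hcc, D.pdR_du_mink_F_G hcc, D.pdR_dv_mink_F_G hcc, h,
    pdR_mink_const S.smooth_F, pdR_mink_const (contDiff_pd S.smooth_F dv)]
  exact hcc.eta_closed_mink w (D.G x) x

end DarbouxTransform

/-- The orthogonal complement of the spherical system consists of the vectors of
`Λ^{(1)}` orthogonal to `Λ̂`. -/
lemma mem_mperp_sphericalSystem (S : IsothermicSurface n) (G : Surf → MV n) (x : Surf)
    (hFG : mink n (S.F x) (G x) ≠ 0) (v : MV n) :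
    v ∈ mperp n (sphericalSystem n S G x)
      ↔ v ∈ Submodule.span ℝ {S.F x, pd du S.F x, pd dv S.F x} ∧ mink n v (G x) = 0 := by
  rw [sphericalSystem, mperp_sup, mperp_mperp, Submodule.mem_inf, mem_mperp_span]
  simp only [Set.mem_insert_iff, Set.mem_singleton_iff, forall_eq_or_imp, forall_eq]
  constructor
  · rintro ⟨⟨hvF, hvG⟩, hv⟩
    refine ⟨?_, hvG⟩
    obtain ⟨a, y, hy, rfl⟩ := Submodule.mem_span_insert.1 hv
    obtain ⟨b, c, d, rfl⟩ := Submodule.mem_span_triple.1 hy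
    simp only [mink_add_left, mink_smul_left, S.F_null, mink_pd_F,
      mink_comm n (G x) (S.F x)] at hvF
    have hd : d = 0 := by simpa [hFG] using hvF
    exact Submodule.mem_span_triple.2 ⟨a, b, c, by rw [hd]; module⟩
  · rintro ⟨hv, hvG⟩
    refine ⟨⟨?_, hvG⟩, Submodule.span_mono ?_ hv⟩
    · obtain ⟨a, b, c, rfl⟩ := Submodule.mem_span_triple.1 hv
      simp only [mink_add_left, mink_smul_left, S.F_null, mink_pd_F]
      ring
    · intro u hu
      simp only [Set.mem_insert_iff, Set.mem_singleton_iff] at hu ⊢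
      tauto

lemma mem_mperp_spherePlanes (S : IsothermicSurface n) (G : Surf → MV n) (w : MV n) (x : Surf)
    (hFG : mink n (S.F x) (G x) ≠ 0) (v : MV n) :
    v ∈ mperp n (spherePlanes n S G w x)
      ↔ v ∈ Submodule.span ℝ {S.F x, pd du S.F x, pd dv S.F x} ∧ mink n v (G x) = 0
        ∧ mink n v w = 0 := by
  rw [spherePlanes, mperp_sup, Submodule.mem_inf, mem_mperp_sphericalSystem S G x hFG,
    mem_mperp_span]
  simp [and_assoc]

end Conformal

section Planes

variable {n : ℕ} {S : IsothermicSurface n} {θ : Surf → ℝ} {m m₁ m₂ : ℝ}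

lemma wedge_add_right (n : ℕ) (a b y z : MV n) :
    wedge n a b (y + z) = wedge n a b y + wedge n a b z := by
  simp only [wedge, mink_add_right]; module

lemma wedge_smul_right (n : ℕ) (a b : MV n) (r : ℝ) (z : MV n) :
    wedge n a b (r • z) = r • wedge n a b z := by
  simp only [wedge, mink_smul_right]; module

/-- Outside the spherical system, the Wronskians of `(F,w)` and `(F,G)` do not both
vanish. -/
lemma wronsk_ne_zero_of_notMem_sphericalSystem (S : IsothermicSurface n) (w G : MV n) (x : Surf)
    (hFG : mink n (S.F x) G ≠ 0) (hw : w ∉ sphericalSystem n S (fun _ => G) x)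
    (hr : mink n (S.F x) w * mink n (pd du S.F x) G
      - mink n (pd du S.F x) w * mink n (S.F x) G = 0) :
    mink n (S.F x) w * mink n (pd dv S.F x) G
      - mink n (pd dv S.F x) w * mink n (S.F x) G ≠ 0 := fun hs => by
  apply hw
  rw [← mperp_mperp n (sphericalSystem n S (fun _ => G) x)]
  intro v hv
  obtain ⟨hv, hvG⟩ := (mem_mperp_sphericalSystem S (fun _ => G) x hFG v).1 hv
  obtain ⟨a, b, c, rfl⟩ := Submodule.mem_span_triple.1 hv
  rw [mink_comm]
  simp only [mink_add_left, mink_smul_left] at hvG ⊢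
  apply mul_left_cancel₀ hFG
  linear_combination mink n (S.F x) w * hvG - b * hr - c * hs

lemma wronsk_relation_of_mem_mperp_spherePlanes {w G : MV n} {x : Surf} {a b c : ℝ}
    (hG : mink n (a • S.F x + b • pd du S.F x + c • pd dv S.F x) G = 0)
    (hw : mink n (a • S.F x + b • pd du S.F x + c • pd dv S.F x) w = 0) :
    b * (mink n (S.F x) w * mink n (pd du S.F x) G
        - mink n (pd du S.F x) w * mink n (S.F x) G)
      + c * (mink n (S.F x) w * mink n (pd dv S.F x) G
        - mink n (pd dv S.F x) w * mink n (S.F x) G) = 0 := by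
  simp only [mink_add_left, mink_smul_left] at hG hw
  linear_combination mink n (S.F x) w * hG - mink n (S.F x) G * hw

lemma ConformalCoords.pd_du_mem_spherePlanes (hcc : ConformalCoords n S θ) (w : MV n)
    (G : Surf → MV n) (x : Surf) (hFG : mink n (S.F x) (G x) ≠ 0)
    (hr : mink n (S.F x) w * mink n (pd du S.F x) (G x)
      - mink n (pd du S.F x) w * mink n (S.F x) (G x) ≠ 0)
    (hs : mink n (S.F x) w * mink n (pd dv S.F x) (G x)
      - mink n (pd dv S.F x) w * mink n (S.F x) (G x) = 0) :
    pd du S.F x ∈ spherePlanes n S G w x := by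
  rw [← mperp_mperp n (spherePlanes n S G w x)]
  intro v hv
  obtain ⟨hv, hvG, hvw⟩ := (mem_mperp_spherePlanes S G w x hFG v).1 hv
  obtain ⟨a, b, c, rfl⟩ := Submodule.mem_span_triple.1 hv
  have h := wronsk_relation_of_mem_mperp_spherePlanes hvG hvw
  rw [hs, mul_zero, add_zero] at h
  have hb : b = 0 := (mul_eq_zero.1 h).resolve_right hr
  simp only [mink_add_right, mink_smul_right, mink_pd_F, hb, hcc.2.2.2.1]
  ring

lemma ConformalCoords.pd_dv_mem_spherePlanes (hcc : ConformalCoords n S θ) (w : MV n)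
    (G : Surf → MV n) (x : Surf) (hFG : mink n (S.F x) (G x) ≠ 0)
    (hr : mink n (S.F x) w * mink n (pd du S.F x) (G x)
      - mink n (pd du S.F x) w * mink n (S.F x) (G x) = 0)
    (hs : mink n (S.F x) w * mink n (pd dv S.F x) (G x)
      - mink n (pd dv S.F x) w * mink n (S.F x) (G x) ≠ 0) :
    pd dv S.F x ∈ spherePlanes n S G w x := by
  rw [← mperp_mperp n (spherePlanes n S G w x)]
  intro v hv
  obtain ⟨hv, hvG, hvw⟩ := (mem_mperp_spherePlanes S G w x hFG v).1 hv
  obtain ⟨a, b, c, rfl⟩ := Submodule.mem_span_triple.1 hv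
  have h := wronsk_relation_of_mem_mperp_spherePlanes hvG hvw
  rw [hr, mul_zero, zero_add] at h
  have hc : c = 0 := (mul_eq_zero.1 h).resolve_right hs
  simp only [mink_add_right, mink_smul_right, mink_pd_F, hc,
    mink_comm n (pd dv S.F x) (pd du S.F x), hcc.2.2.2.1]
  ring

lemma pd_du_notMem_span (S : IsothermicSurface n) (x : Surf) :
    pd du S.F x ∉ Submodule.span ℝ {S.F x} := fun h => by
  obtain ⟨a, ha⟩ := Submodule.mem_span_singleton.1 h
  exact neg_ne_zero.2 one_ne_zero (linComb_F_du S x a (-1) (by rw [ha]; module)).2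

lemma pd_dv_notMem_span (S : IsothermicSurface n) (x : Surf) :
    pd dv S.F x ∉ Submodule.span ℝ {S.F x} := fun h => by
  obtain ⟨a, ha⟩ := Submodule.mem_span_singleton.1 h
  exact neg_ne_zero.2 one_ne_zero (linComb_F_dv S x a (-1) (by rw [ha]; module)).2

/-- Coincidence of the sphere-planes forces the Wronskians to be proportional. -/
lemma wronsk_proportional_of_spherePlanes_eq (w : MV n) (G₁ G₂ : Surf → MV n) (x : Surf)
    (hFG₁ : mink n (S.F x) (G₁ x) ≠ 0) (hFG₂ : mink n (S.F x) (G₂ x) ≠ 0)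
    (h : spherePlanes n S G₁ w x = spherePlanes n S G₂ w x) :
    (mink n (S.F x) w * mink n (pd dv S.F x) (G₁ x)
        - mink n (pd dv S.F x) w * mink n (S.F x) (G₁ x))
      * (mink n (S.F x) w * mink n (pd du S.F x) (G₂ x)
        - mink n (pd du S.F x) w * mink n (S.F x) (G₂ x))
    = (mink n (S.F x) w * mink n (pd du S.F x) (G₁ x)
        - mink n (pd du S.F x) w * mink n (S.F x) (G₁ x))
      * (mink n (S.F x) w * mink n (pd dv S.F x) (G₂ x)
        - mink n (pd dv S.F x) w * mink n (S.F x) (G₂ x)) := by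
  set b := mink n (S.F x) w * mink n (pd dv S.F x) (G₁ x)
        - mink n (pd dv S.F x) w * mink n (S.F x) (G₁ x) with hb
  set c := mink n (pd du S.F x) w * mink n (S.F x) (G₁ x)
    - mink n (S.F x) w * mink n (pd du S.F x) (G₁ x) with hc
  set a := mink n (pd du S.F x) (G₁ x) * mink n (pd dv S.F x) w
    - mink n (pd dv S.F x) (G₁ x) * mink n (pd du S.F x) w with ha
  have hv : a • S.F x + b • pd du S.F x + c • pd dv S.F x
      ∈ mperp n (spherePlanes n S G₁ w x) := by
    rw [mem_mperp_spherePlanes S G₁ w x hFG₁]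
    refine ⟨Submodule.mem_span_triple.2 ⟨a, b, c, rfl⟩, ?_, ?_⟩ <;>
    · simp only [mink_add_left, mink_smul_left, ha, hb, hc]
      ring
  rw [h, mem_mperp_spherePlanes S G₂ w x hFG₂] at hv
  have := wronsk_relation_of_mem_mperp_spherePlanes hv.2.1 hv.2.2
  linear_combination this

/-- The coefficients of a quadratic polynomial of sections. -/
def quadCoeff (a b c : Surf → MV n) : ℕ → Surf → MV n
  | 0 => a
  | 1 => b
  | 2 => c
  | _ + 3 => 0

lemma sum_quadCoeff (a b c : Surf → MV n) (t : ℝ) (x : Surf) :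
    ∑ k ∈ Finset.range (2 + 1), t ^ k • quadCoeff a b c k x
      = a x + t • b x + t ^ 2 • c x := by
  simp [Finset.sum_range_succ, quadCoeff]

/-- The combination of `w` and two Darboux transforms interpolating a quadratic
conserved quantity is parallel as soon as `η` annihilates its leading coefficient. -/
lemma parallelSection_interpolant (D₁ : DarbouxTransform n S m₁) (D₂ : DarbouxTransform n S m₂)
    (w : MV n) (κ δ t : ℝ)
    (h₁ : ∀ x, wedge n (S.F x) (S.W₁ x) ((-δ) • w + κ • D₁.G x + (-1 : ℝ) • D₂.G x) = 0)
    (h₂ : ∀ x, wedge n (S.F x) (S.W₂ x) ((-δ) • w + κ • D₁.G x + (-1 : ℝ) • D₂.G x) = 0) :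
    ParallelSection n S t (fun x => (-δ * (t - m₁) * (t - m₂)) • w
      + (κ * t * (t - m₂)) • D₁.G x + (-t * (t - m₁)) • D₂.G x) := fun x => by
  have hd : ∀ e, fderiv ℝ (fun x => (-δ * (t - m₁) * (t - m₂)) • w
      + (κ * t * (t - m₂)) • D₁.G x + (-t * (t - m₁)) • D₂.G x) x e
      = (κ * t * (t - m₂)) • fderiv ℝ D₁.G x e + (-t * (t - m₁)) • fderiv ℝ D₂.G x e := fun e => by
    have h := ((((D₁.smooth_G.diffAt x).hasFDerivAt.const_smul (κ * t * (t - m₂))).const_add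
      ((-δ * (t - m₁) * (t - m₂)) • w)).add
      ((D₂.smooth_G.diffAt x).hasFDerivAt.const_smul (-t * (t - m₁)))).fderiv
    exact congrArg (fun L => L e) h
  rw [hd, hd]
  have p₁ := D₁.parallel x
  have p₂ := D₂.parallel x
  have q₁ := h₁ x
  have q₂ := h₂ x
  simp only [wedge_add_right, wedge_smul_right] at q₁ q₂ ⊢
  constructor
  · linear_combination (norm := module) (κ * t * (t - m₂)) • p₁.1 + (-t * (t - m₁)) • p₂.1
      + (t * (t - m₁) * (t - m₂)) • q₁
  · linear_combination (norm := module) (κ * t * (t - m₂)) • p₁.2 + (-t * (t - m₁)) • p₂.2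
      + (t * (t - m₁) * (t - m₂)) • q₂

/-- `η` annihilates the top coefficient of a quadratic conserved quantity. -/
lemma PolyConservedQuantity.wedge_coeff_two (p : PolyConservedQuantity n S 2) (x : Surf) :
    wedge n (S.F x) (S.W₁ x) (p.coeff 2 x) = 0 ∧ wedge n (S.F x) (S.W₂ x) (p.coeff 2 x) = 0 := by
  have hd : ∀ t : ℝ, ∀ e, fderiv ℝ (fun x => ∑ k ∈ Finset.range (2 + 1), t ^ k • p.coeff k x) x e
      = fderiv ℝ (p.coeff 0) x e + t • fderiv ℝ (p.coeff 1) x e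
        + t ^ 2 • fderiv ℝ (p.coeff 2) x e := fun t e => by
    have h := HasFDerivAt.fun_sum (u := Finset.range (2 + 1)) fun k _ =>
      ((p.smooth k).diffAt x).hasFDerivAt.const_smul (t ^ k)
    refine (congrArg (fun L => L e) h.fderiv).trans ?_
    simp [Finset.sum_range_succ]
  have key : ∀ t : ℝ, _ := fun t => p.conserved t x
  simp only [hd] at key
  simp only [Finset.sum_range_succ, Finset.sum_range_zero, zero_add, wedge_add_right,
    wedge_smul_right] at key
  have k0 := key 0
  have k1 := key 1
  have k2 := key 2
  have k3 := key (-1)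
  constructor
  · linear_combination (norm := module) (1 / 6 : ℝ) • k2.1 - (1 / 2 : ℝ) • k1.1 + (1 / 2 : ℝ) • k0.1
      - (1 / 6 : ℝ) • k3.1
  · linear_combination (norm := module) (1 / 6 : ℝ) • k2.2 - (1 / 2 : ℝ) • k1.2 + (1 / 2 : ℝ) • k0.2
      - (1 / 6 : ℝ) • k3.2

/-- The top coefficient of a quadratic conserved quantity is normal to `Λ^{(1)}`. -/
lemma ConformalCoords.mink_coeff_two (hcc : ConformalCoords n S θ)
    (p : PolyConservedQuantity n S 2) (x : Surf) (v : MV n)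
    (hv : v ∈ Submodule.span ℝ {S.F x, pd du S.F x, pd dv S.F x}) :
    mink n v (p.coeff 2 x) = 0 := by
  obtain ⟨h₁, h₂⟩ := p.wedge_coeff_two x
  rw [hcc.wedge_W₁, smul_eq_zero_iff_right (invConf_ne_zero θ x)] at h₁
  rw [hcc.wedge_W₂, smul_eq_zero_iff_right (invConf_ne_zero θ x)] at h₂
  obtain ⟨hu, hF⟩ := linComb_F_du S x _ (-mink n (S.F x) (p.coeff 2 x)) (by rw [← h₁]; module)
  obtain ⟨hv', -⟩ := linComb_F_dv S x (-mink n (pd dv S.F x) (p.coeff 2 x))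
    (mink n (S.F x) (p.coeff 2 x)) (by rw [← h₂]; module)
  obtain ⟨a, b, c, rfl⟩ := Submodule.mem_span_triple.1 hv
  simp only [mink_add_left, mink_smul_left]
  rw [hu, neg_eq_zero.1 hF, neg_eq_zero.1 hv']
  ring

/-- A vector of `Λ^{(1)}` orthogonal to `w` and to one complementary surface is
orthogonal to any other. -/
lemma mink_complementary_eq_zero (hcc : ConformalCoords n S θ) (hm₁ : m₁ ≠ 0)
    {D₁ : DarbouxTransform n S m₁} {D₂ : DarbouxTransform n S m₂} {w : MV n}
    (p : PolyConservedQuantity n S 2) (hp : ∃ c : ℝ, ∀ x, p.coeff 0 x = c • w)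
    (h₁ : IsComplementary n p D₁) (h₂ : IsComplementary n p D₂) (x : Surf) (v : MV n)
    (hv : v ∈ Submodule.span ℝ {S.F x, pd du S.F x, pd dv S.F x})
    (hvw : mink n v w = 0) (hvG : mink n v (D₁.G x) = 0) : mink n v (D₂.G x) = 0 := by
  obtain ⟨c, hc⟩ := hp
  have e : ∀ t, mink n v (pcEval p t x) = t * mink n v (p.coeff 1 x) := fun t => by
    simp only [pcEval, Finset.sum_range_succ, Finset.sum_range_zero, zero_add, mink_add_right,
      mink_smul_right, hcc.mink_coeff_two p x v hv, hc, hvw]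
    ring
  have g₁ : pcEval p m₁ x ∈ Submodule.span ℝ {D₁.G x} := by
    rw [h₁.2 x]; exact Submodule.mem_span_singleton_self _
  have g₂ : D₂.G x ∈ Submodule.span ℝ {pcEval p m₂ x} := by
    rw [← h₂.2 x]; exact Submodule.mem_span_singleton_self _
  obtain ⟨a, ha⟩ := Submodule.mem_span_singleton.1 g₁
  obtain ⟨b, hb⟩ := Submodule.mem_span_singleton.1 g₂
  have h0 := e m₁
  rw [← ha, mink_smul_right, hvG, mul_zero, zero_eq_mul] at h0
  rw [← hb, mink_smul_right, e, h0.resolve_left hm₁]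
  ring

lemma spherePlanes_eq_of_isComplementary (hcc : ConformalCoords n S θ) (hm₁ : m₁ ≠ 0)
    (hm₂ : m₂ ≠ 0) {D₁ : DarbouxTransform n S m₁} {D₂ : DarbouxTransform n S m₂} {w : MV n}
    (p : PolyConservedQuantity n S 2) (hp : ∃ c : ℝ, ∀ x, p.coeff 0 x = c • w)
    (h₁ : IsComplementary n p D₁) (h₂ : IsComplementary n p D₂) (x : Surf) :
    spherePlanes n S D₁.G w x = spherePlanes n S D₂.G w x := by
  rw [← mperp_mperp n (spherePlanes n S D₁.G w x), ← mperp_mperp n (spherePlanes n S D₂.G w x)]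
  congr 1
  ext v
  rw [mem_mperp_spherePlanes S D₁.G w x (D₁.mink_F_G_ne_zero x),
    mem_mperp_spherePlanes S D₂.G w x (D₂.mink_F_G_ne_zero x)]
  exact ⟨fun ⟨hv, hG, hw⟩ => ⟨hv, mink_complementary_eq_zero hcc hm₁ p hp h₁ h₂ x v hv hw hG, hw⟩,
    fun ⟨hv, hG, hw⟩ => ⟨hv, mink_complementary_eq_zero hcc hm₂ p hp h₂ h₁ x v hv hw hG, hw⟩⟩

/-- The leading coefficient of the interpolating quadratic polynomial does not vanish
identically. -/
lemma leadingCoeff_ne_zero (hcc : ConformalCoords n S θ) (hne : m₁ ≠ m₂)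
    (D₁ : DarbouxTransform n S m₁) (D₂ : DarbouxTransform n S m₂) (w : MV n) {κ δ : ℝ}
    (hκ0 : κ ≠ 0) (x : Surf)
    (hr : mink n (S.F x) w * mink n (pd du S.F x) (D₁.G x)
      - mink n (pd du S.F x) w * mink n (S.F x) (D₁.G x) ≠ 0)
    (hb : mink n (S.F x) w * mink n (pd du S.F x) (D₂.G x)
        - mink n (pd du S.F x) w * mink n (S.F x) (D₂.G x)
      = κ * (mink n (S.F x) w * mink n (pd du S.F x) (D₁.G x)
        - mink n (pd du S.F x) w * mink n (S.F x) (D₁.G x))) :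
    (fun y => (-δ) • w + κ • D₁.G y + (-1 : ℝ) • D₂.G y) ≠ 0 := fun h0 => by
  have hG : (fun x => κ * mink n (D₁.G x) w - mink n (D₂.G x) w)
      = fun _ => δ * mink n w w := funext fun y => by
    have h := congrArg (fun v => mink n v w) (congrFun h0 y)
    simp only [mink_add_left, mink_smul_left, Pi.zero_apply, mink_zero_left] at h
    linear_combination h
  have s₁ : ContDiff ℝ (⊤ : ℕ∞) (fun x => mink n (D₁.G x) w) := D₁.smooth_G.mink contDiff_const
  have s₂ : ContDiff ℝ (⊤ : ℕ∞) (fun x => mink n (D₂.G x) w) := D₂.smooth_G.mink contDiff_const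
  have a := congrArg (fun f => pdR du f x) hG
  have a0 : pdR du (fun _ : Surf => δ * mink n w w) x = 0 := by simp [pdR]
  rw [a0, pdR_sub (contDiff_const.mul s₁) s₂, pdR_const_mul s₁, pdR_mink_const D₁.smooth_G,
    pdR_mink_const D₂.smooth_G, D₁.pd_du_G hcc, D₂.pd_du_G hcc] at a
  simp only [mink_smul_left, mink_sub_left] at a
  have hz : invConf θ x * (m₁ - m₂) * κ = 0 := by
    apply mul_right_cancel₀ hr
    linear_combination -a + m₂ * invConf θ x * hb
  simp [invConf_ne_zero, sub_ne_zero.2 hne, hκ0] at hz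

lemma exists_polyConservedQuantity (hcc : ConformalCoords n S θ) (hm₁ : m₁ ≠ 0)
    (hm₂ : m₂ ≠ 0) (hne : m₁ ≠ m₂) (D₁ : DarbouxTransform n S m₁) (D₂ : DarbouxTransform n S m₂)
    (w : MV n) (hW : ∀ x, mink n w (S.F x) ≠ 0)
    (hC₁ : ∀ x, w ∉ sphericalSystem n S D₁.G x) (hC₂ : ∀ x, w ∉ sphericalSystem n S D₂.G x)
    (hP : ∀ x, spherePlanes n S D₁.G w x = spherePlanes n S D₂.G w x)
    (hu : ∀ x, Submodule.span ℝ {S.F x, pd du S.F x} ⊓ spherePlanes n S D₁.G w x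
      = Submodule.span ℝ {S.F x})
    (hv : ∀ x, Submodule.span ℝ {S.F x, pd dv S.F x} ⊓ spherePlanes n S D₁.G w x
      = Submodule.span ℝ {S.F x}) :
    ∃ p : PolyConservedQuantity n S 2,
      (∃ c : ℝ, ∀ x, p.coeff 0 x = c • w) ∧ IsComplementary n p D₁ ∧ IsComplementary n p D₂ := by
  have hW' : ∀ x, mink n (S.F x) w ≠ 0 := fun x => by rw [mink_comm]; exact hW x
  have hFw : ContDiff ℝ (⊤ : ℕ∞) (fun x => mink n (S.F x) w) := S.smooth_F.mink contDiff_const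
  -- the Wronskians of `(F,w)` and `(F,Gᵢ)` in terms of the first derivatives of `F`
  have wu : ∀ {m : ℝ} (D : DarbouxTransform n S m) (x : Surf),
      wronsk (fun x => mink n (S.F x) w) (fun x => mink n (S.F x) (D.G x)) du x
      = mink n (S.F x) w * mink n (pd du S.F x) (D.G x)
        - mink n (pd du S.F x) w * mink n (S.F x) (D.G x) := fun D x => by
    rw [wronsk, D.pdR_du_mink_F_G hcc, pdR_mink_const S.smooth_F]
  have wv : ∀ {m : ℝ} (D : DarbouxTransform n S m) (x : Surf),
      wronsk (fun x => mink n (S.F x) w) (fun x => mink n (S.F x) (D.G x)) dv x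
      = mink n (S.F x) w * mink n (pd dv S.F x) (D.G x)
        - mink n (pd dv S.F x) w * mink n (S.F x) (D.G x) := fun D x => by
    rw [wronsk, D.pdR_dv_mink_F_G hcc, pdR_mink_const S.smooth_F]
  have hs : ∀ x, wronsk (fun x => mink n (S.F x) w)
      (fun x => mink n (S.F x) (D₁.G x)) dv x ≠ 0 := fun x h => by
    rw [wv] at h
    have hr := fun hr => wronsk_ne_zero_of_notMem_sphericalSystem S w (D₁.G x) x
      (D₁.mink_F_G_ne_zero x) (hC₁ x) hr h
    refine pd_du_notMem_span S x ?_
    rw [← hu x]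
    exact ⟨Submodule.subset_span (by simp),
      hcc.pd_du_mem_spherePlanes w D₁.G x (D₁.mink_F_G_ne_zero x) hr h⟩
  have hr : ∀ x, wronsk (fun x => mink n (S.F x) w)
      (fun x => mink n (S.F x) (D₁.G x)) du x ≠ 0 := fun x h => by
    have hs' := hs x
    rw [wu] at h
    rw [wv] at hs'
    refine pd_dv_notMem_span S x ?_
    rw [← hv x]
    exact ⟨Submodule.subset_span (by simp),
      hcc.pd_dv_mem_spherePlanes w D₁.G x (D₁.mink_F_G_ne_zero x) h hs'⟩
  obtain ⟨κ, δ, hκ, hwr⟩ := exists_const_of_wronsk_proportional hFw D₁.contDiff_mink_F_G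
    D₂.contDiff_mink_F_G (invConf_ne_zero θ) hW' (D₁.conjugateNetEq hcc w)
    (D₂.conjugateNetEq hcc w) hr hs (fun x => by
      rw [wu, wu, wv, wv]
      exact wronsk_proportional_of_spherePlanes_eq w D₁.G D₂.G x
        (D₁.mink_F_G_ne_zero x) (D₂.mink_F_G_ne_zero x) (hP x))
  have hru := hwr du (by simp)
  have hrv := hwr dv (by simp)
  have hκ0 : κ ≠ 0 := fun h0 => by
    have a := hru 0
    have b := hrv 0
    rw [h0, zero_mul, wu] at a
    rw [h0, zero_mul, wv] at b
    exact wronsk_ne_zero_of_notMem_sphericalSystem S w (D₂.G 0) 0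
      (D₂.mink_F_G_ne_zero 0) (hC₂ 0) a b
  -- the leading coefficient is normal to `Λ^{(1)}`
  have hκe : ∀ e x, κ * pdR e (fun y => mink n (S.F y) (D₁.G y)) x
      - pdR e (fun y => mink n (S.F y) (D₂.G y)) x = δ * mink n (pd e S.F x) w := fun e x => by
    rw [← pdR_mink_const S.smooth_F w e x, ← pdR_const_mul hFw,
      ← pdR_const_mul D₁.contDiff_mink_F_G,
      ← pdR_sub (contDiff_const.mul D₁.contDiff_mink_F_G) D₂.contDiff_mink_F_G]
    exact congrArg (fun f => pdR e f x) (funext hκ)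
  have htop : ∀ x, mink n (S.F x) ((-δ) • w + κ • D₁.G x + (-1 : ℝ) • D₂.G x) = 0
      ∧ mink n (pd du S.F x) ((-δ) • w + κ • D₁.G x + (-1 : ℝ) • D₂.G x) = 0
      ∧ mink n (pd dv S.F x) ((-δ) • w + κ • D₁.G x + (-1 : ℝ) • D₂.G x) = 0 := fun x => by
    have a := hκ x
    have b := hκe du x
    have c := hκe dv x
    rw [D₁.pdR_du_mink_F_G hcc, D₂.pdR_du_mink_F_G hcc] at b
    rw [D₁.pdR_dv_mink_F_G hcc, D₂.pdR_dv_mink_F_G hcc] at c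
    simp only [mink_add_right, mink_smul_right]
    exact ⟨by linear_combination a, by linear_combination b, by linear_combination c⟩
  set p₀ : Surf → MV n := fun _ => (-δ * m₁ * m₂) • w with hp₀
  set p₁ : Surf → MV n := fun x => (δ * (m₁ + m₂)) • w + (-κ * m₂) • D₁.G x + m₁ • D₂.G x with hp₁
  set p₂ : Surf → MV n := fun x => (-δ) • w + κ • D₁.G x + (-1 : ℝ) • D₂.G x with hp₂
  have hsum : ∀ (t : ℝ) (x : Surf), ∑ k ∈ Finset.range (2 + 1), t ^ k • quadCoeff p₀ p₁ p₂ k x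
      = (-δ * (t - m₁) * (t - m₂)) • w + (κ * t * (t - m₂)) • D₁.G x
        + (-t * (t - m₁)) • D₂.G x := fun t x => by
    rw [sum_quadCoeff]
    simp only [hp₀, hp₁, hp₂]
    module
  have hp₂0 : p₂ ≠ 0 := by
    have a := hr 0
    have b := hru 0
    rw [wu] at a
    rw [wu, wu] at b
    exact leadingCoeff_ne_zero hcc hne D₁ D₂ w hκ0 0 a b
  refine ⟨⟨quadCoeff p₀ p₁ p₂, ?_, ?_, hp₂0, ?_⟩, ⟨-δ * m₁ * m₂, fun x => rfl⟩, ?_, ?_⟩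
  · rintro (_ | _ | _ | k)
    · exact contDiff_const
    · exact (contDiff_const.add (D₁.smooth_G.const_smul (-κ * m₂))).add
        (D₂.smooth_G.const_smul m₁)
    · exact (contDiff_const.add (D₁.smooth_G.const_smul κ)).add
        (D₂.smooth_G.const_smul (-1 : ℝ))
    · exact contDiff_const
  · rintro (_ | _ | _ | k) hk
    · omega
    · omega
    · omega
    · rfl
  · intro t
    simp only [hsum]
    refine parallelSection_interpolant D₁ D₂ w κ δ t (fun x => ?_) (fun x => ?_)
    · rw [hcc.wedge_W₁, (htop x).1, (htop x).2.1]; module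
    · rw [hcc.wedge_W₂, (htop x).1, (htop x).2.2]; module
  · have he : ∀ x, ∑ k ∈ Finset.range (2 + 1), m₁ ^ k • quadCoeff p₀ p₁ p₂ k x
        = (κ * m₁ * (m₁ - m₂)) • D₁.G x := fun x => by rw [hsum]; module
    simp only [IsComplementary, pcEval, he]
    refine ⟨fun x => by
      simp only [mink_smul_left, mink_smul_right, D₁.G_null, mul_zero], fun x => ?_⟩
    exact (Submodule.span_singleton_smul_eq
      (IsUnit.mk0 _ (mul_ne_zero (mul_ne_zero hκ0 hm₁) (sub_ne_zero.2 hne))) _).symm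
  · have he : ∀ x, ∑ k ∈ Finset.range (2 + 1), m₂ ^ k • quadCoeff p₀ p₁ p₂ k x
        = (-m₂ * (m₂ - m₁)) • D₂.G x := fun x => by rw [hsum]; module
    simp only [IsComplementary, pcEval, he]
    refine ⟨fun x => by
      simp only [mink_smul_left, mink_smul_right, D₂.G_null, mul_zero], fun x => ?_⟩
    exact (Submodule.span_singleton_smul_eq
      (IsUnit.mk0 _ (mul_ne_zero (neg_ne_zero.2 hm₂) (sub_ne_zero.2 hne.symm))) _).symm

end Planes

/-- Theorem: if two Darboux transforms of a full isothermic surface with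
distinct parameters have coincident sphere-planes with respect to `w`, and the
sphere-planes contain no principal direction, then the surface is special
isothermic of type `2` with `p₀ ∈ ⟨w⟩` and the two Darboux transforms are
complementary surfaces; conversely, the sphere-planes through any two
complementary surfaces of a special isothermic surface of type `2` in `E(w)`
coincide. -/
theorem sphere_planes_characterisation (n : ℕ) (hn : 3 ≤ n)
    (S : IsothermicSurface n) (hfull : Full n S)
    (θ : Surf → ℝ) (hcc : ConformalCoords n S θ)
    (m₁ m₂ : ℝ) (hm₁ : m₁ ≠ 0) (hm₂ : m₂ ≠ 0) (hne : m₁ ≠ m₂)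
    (D₁ : DarbouxTransform n S m₁) (D₂ : DarbouxTransform n S m₂)
    (w : MV n) :
    ((∀ x, mink n w (S.F x) ≠ 0) →
      (∀ x, w ∉ sphericalSystem n S D₁.G x) →
      (∀ x, w ∉ sphericalSystem n S D₂.G x) →
      (∀ x, spherePlanes n S D₁.G w x = spherePlanes n S D₂.G w x) →
      (∀ x, Submodule.span ℝ {S.F x, pd du S.F x} ⊓ spherePlanes n S D₁.G w x
          = Submodule.span ℝ {S.F x}) →
      (∀ x, Submodule.span ℝ {S.F x, pd dv S.F x} ⊓ spherePlanes n S D₁.G w x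
          = Submodule.span ℝ {S.F x}) →
      ∃ p : PolyConservedQuantity n S 2,
        (∃ c : ℝ, ∀ x, p.coeff 0 x = c • w)
        ∧ IsComplementary n p D₁ ∧ IsComplementary n p D₂)
    ∧ (∀ p : PolyConservedQuantity n S 2,
        (∃ c : ℝ, ∀ x, p.coeff 0 x = c • w) →
        IsComplementary n p D₁ → IsComplementary n p D₂ →
        ∀ x, spherePlanes n S D₁.G w x = spherePlanes n S D₂.G w x) := by
  exact ⟨exists_polyConservedQuantity hcc hm₁ hm₂ hne D₁ D₂ w,
    fun p hp h₁ h₂ => spherePlanes_eq_of_isComplementary hcc hm₁ hm₂ p hp h₁ h₂⟩
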